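/- Generating function for skew doubled shifted plane partitions: let m ≥ 2 and let δ=(δ_i)_{1≤i≤m−1} be a profile. Define the multisets W_1(δ) = {m} ∪ {i : δ_i=−1} ∪ {m−i : δ_i=1} and W_2(δ) = {i+j : 1≤i<j≤m−1, δ_i=δ_j=−1} ∪ {2m−i−j : 1≤i<j≤m−1, δ_i=δ_j=1} ∪ {2m+i−j : 1≤i<j≤m−1, δ_i<δ_j} ∪ {j−i : 1≤i<j≤m−1, δ_i>δ_j}. Then Σ_{ω ∈ DSPP_δ} z^{|ω|} = ∏_{k≥0} (∏_{t∈W_1(δ)} (1−z^{mk+t})^{−1}) (∏_{t∈W_2(δ)} (1−z^{2mk+t})^{−1}), as an identity of formal power series in z. -/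

import Mathlib

open scoped BigOperators

/-- An integer partition: a weakly decreasing, finitely supported sequence of
nonnegative integers. -/
structure Ptn where
  toFun : ℕ →₀ ℕ
  antitone' : ∀ ⦃i j : ℕ⦄, i ≤ j → toFun j ≤ toFun i

namespace Ptn
/-- the `i`-th part (0-indexed) -/
def part (lam : Ptn) (i : ℕ) : ℕ := lam.toFun i
/-- the size `|λ|` -/
def size (lam : Ptn) : ℕ := lam.toFun.sum fun _ k => k
end Ptn

/-- `HStrip μ λ` means `μ ≺ λ`, i.e. `λ/μ` is a horizontal strip:
`λ_i ≥ μ_i ≥ λ_{i+1}` for all `i`. -/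
def HStrip (mu lam : Ptn) : Prop :=
  ∀ i : ℕ, mu.part i ≤ lam.part i ∧ lam.part (i + 1) ≤ mu.part i
/-- `δ` is a `±1`-profile on the indices `1, …, h` -/
def IsProfile (h : ℕ) (δ : ℕ → ℤ) : Prop := ∀ i, 1 ≤ i → i ≤ h → δ i = 1 ∨ δ i = -1

/-- A skew doubled shifted plane partition `ω = (λ^0, …, λ^{m-1})` with profile
`(δ_1, …, δ_{m-1})`: if `δ_{i+1} = 1` then `λ^i ≺ λ^{i+1}`, and if
`δ_{i+1} = -1` then `λ^i ≻ λ^{i+1}`. -/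
def IsDSPP (m : ℕ) (δ : ℕ → ℤ) (L : Fin m → Ptn) : Prop :=
  ∀ (i : ℕ) (hi : i + 1 < m),
    if δ (i + 1) = 1 then HStrip (L ⟨i, Nat.lt_of_succ_lt hi⟩) (L ⟨i + 1, hi⟩)
    else HStrip (L ⟨i + 1, hi⟩) (L ⟨i, Nat.lt_of_succ_lt hi⟩)
/-- the coefficientwise (product) topology on formal power series -/
instance : TopologicalSpace (PowerSeries ℚ) :=
  inferInstanceAs (TopologicalSpace ((Unit →₀ ℕ) → ℚ))

/-- the multiset `W_1(δ) = {m} ∪ {i : δ_i = -1} ∪ {m - i : δ_i = 1}` -/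
def W1 (m : ℕ) (δ : ℕ → ℤ) : Multiset ℕ :=
  m ::ₘ (Finset.Icc 1 (m - 1)).val.map (fun i => if δ i = -1 then i else m - i)

/-- the multiset
`W_2(δ) = {i+j : i<j, δ_i=δ_j=-1} ∪ {2m-i-j : i<j, δ_i=δ_j=1}
          ∪ {2m+i-j : i<j, δ_i<δ_j} ∪ {j-i : i<j, δ_i>δ_j}`,
where `1 ≤ i < j ≤ m-1` -/
def W2 (m : ℕ) (δ : ℕ → ℤ) : Multiset ℕ :=
  ((((Finset.Icc 1 (m - 1)) ×ˢ (Finset.Icc 1 (m - 1))).filter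
      (fun q => q.1 < q.2)).val).map
    (fun q =>
      if δ q.1 = -1 ∧ δ q.2 = -1 then q.1 + q.2
      else if δ q.1 = 1 ∧ δ q.2 = 1 then 2 * m - q.1 - q.2
      else if δ q.1 < δ q.2 then 2 * m + q.1 - q.2
      else q.2 - q.1)

/-- the formal variable `z` -/
noncomputable def z : PowerSeries ℚ := PowerSeries.X

/-- Power series with coefficients in `[0, ∞]`; in this semiring every family can be summed. -/
abbrev ESeries : Type := PowerSeries ENNReal

open PowerSeries in
/-- The coefficientwise sum of an arbitrary family of series. -/
noncomputable def gsum {ι : Type*} (f : ι → ESeries) : ESeries :=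
  PowerSeries.mk fun n => ∑' i, coeff n (f i)

section gsum

open PowerSeries

variable {ι κ : Type*}

lemma coeff_gsum (f : ι → ESeries) (n : ℕ) : coeff n (gsum f) = ∑' i, coeff n (f i) :=
  coeff_mk _ _

lemma gsum_add (f g : ι → ESeries) : gsum (fun i => f i + g i) = gsum f + gsum g := by
  ext n
  simp [coeff_gsum, ENNReal.tsum_add]

lemma mul_gsum (a : ESeries) (f : ι → ESeries) : a * gsum f = gsum fun i => a * f i := by
  ext n
  simp only [coeff_gsum, coeff_mul, ← ENNReal.tsum_mul_left]
  rw [Summable.tsum_finsetSum fun _ _ => ENNReal.summable]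

lemma gsum_mul (a : ESeries) (f : ι → ESeries) : gsum f * a = gsum fun i => f i * a := by
  simp only [mul_comm _ a, mul_gsum]

lemma gsum_comm (f : ι → κ → ESeries) :
    gsum (fun i => gsum fun j => f i j) = gsum fun j => gsum fun i => f i j := by
  ext n
  simp only [coeff_gsum]
  exact ENNReal.tsum_comm

lemma gsum_prod (f : ι × κ → ESeries) : gsum f = gsum fun i => gsum fun j => f (i, j) := by
  ext n
  simp only [coeff_gsum]
  exact ENNReal.tsum_prod'

lemma gsum_equiv (e : ι ≃ κ) (f : κ → ESeries) : (gsum fun i => f (e i)) = gsum f := by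
  ext n
  simp only [coeff_gsum]
  exact e.tsum_eq fun j => coeff n (f j)

open Classical in
lemma gsum_ite (p : ι → Prop) (f : ι → ESeries) :
    (gsum fun i => if p i then f i else 0) = gsum fun i : {i // p i} => f i := by
  ext n
  simp only [coeff_gsum]
  have h := tsum_subtype {i | p i} fun i => coeff n (f i)
  refine Eq.trans (tsum_congr fun i => ?_) h.symm
  by_cases hi : p i <;> simp [Set.indicator, hi]

open Classical in
lemma gsum_single (i : ι) (f : ι → ESeries) : (gsum fun j => if i = j then f j else 0) = f i := by
  ext n
  rw [coeff_gsum, tsum_eq_single i]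
  · simp
  · intro j hj
    simp [hj.symm]

end gsum

/-- The geometric series `∑ₙ xⁿ`. -/
noncomputable def geom (x : ESeries) : ESeries := gsum fun n : ℕ => x ^ n

lemma geom_zero : geom 0 = 1 := by
  have h := gsum_single 0 fun _ : ℕ => (1 : ESeries)
  rw [← h]
  refine congrArg gsum (funext fun n => ?_)
  by_cases hn : n = 0
  · simp [hn]
  · simp [hn, Ne.symm hn]

namespace Ptn

@[ext] lemma ext_part {a b : Ptn} (h : ∀ i, a.part i = b.part i) : a = b := by
  cases a; cases b
  congr 1
  exact Finsupp.ext h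

lemma part_anti (a : Ptn) {i j : ℕ} (h : i ≤ j) : a.part j ≤ a.part i := a.antitone' h

lemma exists_bound (a : Ptn) : ∃ N, ∀ i, N ≤ i → a.part i = 0 := by
  refine ⟨a.toFun.support.sup id + 1, fun i hi => ?_⟩
  by_contra h
  have : i ∈ a.toFun.support := Finsupp.mem_support_iff.mpr h
  have := Finset.le_sup (f := id) this
  simp only [id] at this
  omega

lemma size_eq_sum (a : Ptn) {N : ℕ} (h : ∀ i, N ≤ i → a.part i = 0) :
    a.size = ∑ i ∈ Finset.range N, a.part i := by
  refine Finsupp.sum_of_support_subset _ (fun i hi => ?_) _ (by simp)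
  by_contra hN
  exact Finsupp.mem_support_iff.mp hi (h i (by simpa using hN))

/-- The partition with a given antitone, eventually zero sequence of parts. -/
noncomputable def ofFun (f : ℕ → ℕ) (h : ∀ i, f (i + 1) ≤ f i) (hN : ∃ N, ∀ i, N ≤ i → f i = 0) :
    Ptn where
  toFun := Finsupp.ofSupportFinite f <| by
    obtain ⟨N, hN⟩ := hN
    refine (Set.finite_lt_nat N).subset fun i hi => ?_
    by_contra hi'
    exact hi (hN i (by simpa using hi'))
  antitone' := fun _ _ hij => antitone_nat_of_succ_le h hij

@[simp] lemma part_ofFun (f : ℕ → ℕ) (h hN) (i : ℕ) : (ofFun f h hN).part i = f i := rfl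

end Ptn

namespace HStrip

variable {mu lam : Ptn}

lemma size_le (h : HStrip mu lam) : mu.size ≤ lam.size := by
  obtain ⟨N, hN⟩ := lam.exists_bound
  rw [lam.size_eq_sum hN, mu.size_eq_sum fun i hi => Nat.le_zero.mp (hN i hi ▸ (h i).1)]
  exact Finset.sum_le_sum fun i _ => (h i).1

lemma eq_of_size_le (h : HStrip mu lam) (hs : lam.size ≤ mu.size) : mu = lam := by
  obtain ⟨N, hN⟩ := lam.exists_bound
  have hN' : ∀ i, N ≤ i → mu.part i = 0 := fun i hi => Nat.le_zero.mp (hN i hi ▸ (h i).1)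
  have he := le_antisymm h.size_le hs
  rw [lam.size_eq_sum hN, mu.size_eq_sum hN',
    Finset.sum_eq_sum_iff_of_le fun i _ => (h i).1] at he
  ext i
  by_cases hi : i < N
  · exact he i (by simpa using hi)
  · rw [hN i (by omega), hN' i (by omega)]

lemma refl (mu : Ptn) : HStrip mu mu := fun i => ⟨le_rfl, mu.part_anti (by omega)⟩

end HStrip

section toggle

variable (mu nu : Ptn)

/-- The parts obtained from `κ ≺ μ, ν` by reflecting each part in its allowed interval and adding
a new first part. -/
def toggleUpParts (a : ℕ) (kap : Ptn) : ℕ → ℕ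
  | 0 => max (mu.part 0) (nu.part 0) + a
  | i + 1 => max (mu.part (i + 1)) (nu.part (i + 1)) + min (mu.part i) (nu.part i) - kap.part i

/-- The local bijection behind the Cauchy identity: common upper neighbours of `μ` and `ν`
correspond to common lower neighbours together with a natural number. -/
noncomputable def toggle :
    {lam : Ptn // HStrip mu lam ∧ HStrip nu lam} ≃
      ℕ × {kap : Ptn // HStrip kap mu ∧ HStrip kap nu} where
  toFun lam :=
    ⟨lam.1.part 0 - max (mu.part 0) (nu.part 0),
      Ptn.ofFun (fun i => max (mu.part (i + 1)) (nu.part (i + 1)) + min (mu.part i) (nu.part i)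
          - lam.1.part (i + 1))
        (fun i => by
          have h1 := lam.2.1 (i + 1); have h2 := lam.2.2 (i + 1)
          have h3 := lam.2.1 i; have h4 := lam.2.2 i
          have h5 := lam.2.1 (i + 2); have h6 := lam.2.2 (i + 2)
          simp only [add_assoc, Nat.reduceAdd] at *
          omega)
        (by
          obtain ⟨N, hN⟩ := mu.exists_bound
          obtain ⟨N', hN'⟩ := nu.exists_bound
          refine ⟨max N N', fun i hi => ?_⟩
          have h1 := hN i (by omega); have h2 := hN' i (by omega)
          have h3 := hN (i + 1) (by omega); have h4 := hN' (i + 1) (by omega)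
          omega),
      fun i => by
        have h1 := lam.2.1 i; have h2 := lam.2.2 i
        have h3 := lam.2.1 (i + 1); have h4 := lam.2.2 (i + 1)
        simp only [Ptn.part_ofFun]
        omega,
      fun i => by
        have h1 := lam.2.1 i; have h2 := lam.2.2 i
        have h3 := lam.2.1 (i + 1); have h4 := lam.2.2 (i + 1)
        simp only [Ptn.part_ofFun]
        omega⟩
  invFun p :=
    ⟨Ptn.ofFun (toggleUpParts mu nu p.1 p.2.1)
        (fun i => by
          have h1 := p.2.2.1 i; have h2 := p.2.2.2 i
          cases i with
          | zero => simp only [toggleUpParts]; omega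
          | succ i =>
            have h3 := p.2.2.1 (i + 1); have h4 := p.2.2.2 (i + 1)
            have h5 := p.2.2.1 i; have h6 := p.2.2.2 i
            simp only [toggleUpParts]
            omega)
        (by
          obtain ⟨N, hN⟩ := mu.exists_bound
          obtain ⟨N', hN'⟩ := nu.exists_bound
          refine ⟨max N N' + 1, fun i hi => ?_⟩
          obtain ⟨i, rfl⟩ : ∃ j, i = j + 1 := ⟨i - 1, by omega⟩
          have h1 := hN i (by omega); have h2 := hN' i (by omega)
          have h3 := hN (i + 1) (by omega); have h4 := hN' (i + 1) (by omega)
          simp only [toggleUpParts]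
          omega),
      fun i => by
        have h1 := p.2.2.1 i; have h2 := p.2.2.2 i
        cases i with
        | zero => simp only [Ptn.part_ofFun, toggleUpParts]; omega
        | succ i =>
          have h5 := p.2.2.1 i; have h6 := p.2.2.2 i
          simp only [Ptn.part_ofFun, toggleUpParts]
          omega,
      fun i => by
        have h1 := p.2.2.1 i; have h2 := p.2.2.2 i
        cases i with
        | zero => simp only [Ptn.part_ofFun, toggleUpParts]; omega
        | succ i =>
          have h5 := p.2.2.1 i; have h6 := p.2.2.2 i
          simp only [Ptn.part_ofFun, toggleUpParts]
          omega⟩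
  left_inv lam := by
    ext i
    cases i with
    | zero =>
      have h1 := lam.2.1 0; have h2 := lam.2.2 0
      simp only [Ptn.part_ofFun, toggleUpParts]
      omega
    | succ i =>
      have h1 := lam.2.1 i; have h2 := lam.2.2 i
      have h3 := lam.2.1 (i + 1); have h4 := lam.2.2 (i + 1)
      simp only [Ptn.part_ofFun, toggleUpParts]
      omega
  right_inv p := by
    refine Prod.ext ?_ (Subtype.ext (Ptn.ext_part fun i => ?_))
    · simp [toggleUpParts]
    · have h1 := p.2.2.1 i; have h2 := p.2.2.2 i
      simp only [Ptn.part_ofFun, toggleUpParts]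
      omega

lemma size_toggle_symm (p : ℕ × {kap : Ptn // HStrip kap mu ∧ HStrip kap nu}) :
    ((toggle mu nu).symm p).1.size + p.2.1.size = p.1 + mu.size + nu.size := by
  obtain ⟨N, hN⟩ := mu.exists_bound
  obtain ⟨N', hN'⟩ := nu.exists_bound
  obtain ⟨a, kap, hk1, hk2⟩ := p
  set M := max N N'
  have hmu : ∀ i, M ≤ i → mu.part i = 0 := fun i hi => hN i (by omega)
  have hnu : ∀ i, M ≤ i → nu.part i = 0 := fun i hi => hN' i (by omega)
  have hkap : ∀ i, M ≤ i → kap.part i = 0 := fun i hi => by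
    have := (hk1 i).1; have := hmu i hi; omega
  have hlam : ∀ i, M + 1 ≤ i →
      ((toggle mu nu).symm (a, ⟨kap, hk1, hk2⟩)).1.part i = 0 := fun i hi => by
    obtain ⟨i, rfl⟩ : ∃ j, i = j + 1 := ⟨i - 1, by omega⟩
    have h1 := hmu i (by omega); have h2 := hmu (i + 1) (by omega)
    have h3 := hnu i (by omega); have h4 := hnu (i + 1) (by omega)
    simp only [toggle, Equiv.coe_fn_symm_mk, Ptn.part_ofFun, toggleUpParts]
    omega
  have hM : max (mu.part M) (nu.part M) = 0 := by simp [hmu M le_rfl, hnu M le_rfl]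
  have hmax := Finset.sum_range_succ' (fun i => max (mu.part i) (nu.part i)) M
  rw [Finset.sum_range_succ, hM] at hmax
  rw [Ptn.size_eq_sum _ hlam, Ptn.size_eq_sum _ hmu, Ptn.size_eq_sum _ hnu,
    Ptn.size_eq_sum _ hkap, Finset.sum_range_succ']
  simp only [toggle, Equiv.coe_fn_symm_mk, Ptn.part_ofFun, toggleUpParts]
  have key : ∑ i ∈ Finset.range M, (max (mu.part (i + 1)) (nu.part (i + 1))
        + min (mu.part i) (nu.part i) - kap.part i) + ∑ i ∈ Finset.range M, kap.part i
      = ∑ i ∈ Finset.range M, max (mu.part (i + 1)) (nu.part (i + 1))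
        + ∑ i ∈ Finset.range M, min (mu.part i) (nu.part i) := by
    rw [← Finset.sum_add_distrib, ← Finset.sum_add_distrib]
    refine Finset.sum_congr rfl fun i _ => ?_
    have h1 := hk1 i; have h2 := hk2 i
    omega
  have hmm : ∑ i ∈ Finset.range M, max (mu.part i) (nu.part i)
        + ∑ i ∈ Finset.range M, min (mu.part i) (nu.part i)
      = ∑ i ∈ Finset.range M, mu.part i + ∑ i ∈ Finset.range M, nu.part i := by
    rw [← Finset.sum_add_distrib, ← Finset.sum_add_distrib]
    exact Finset.sum_congr rfl fun i _ => max_add_min _ _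
  omega

end toggle

open Classical in
/-- The one-variable skew Schur weight `x^|λ/μ|` if `μ ≺ λ`, and `0` otherwise. -/
noncomputable def wt (x : ESeries) (mu lam : Ptn) : ESeries :=
  if HStrip mu lam then x ^ (lam.size - mu.size) else 0

open Classical in
lemma wt_zero (mu lam : Ptn) : wt 0 mu lam = if mu = lam then 1 else 0 := by
  unfold wt
  by_cases h : mu = lam
  · simp [h, HStrip.refl]
  · by_cases hs : HStrip mu lam
    · have : lam.size - mu.size ≠ 0 := fun h0 => h (hs.eq_of_size_le (by omega))
      simp [hs, h, this]
    · simp [hs, h]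

lemma pow_size_mul_wt (q x : ESeries) (mu lam : Ptn) :
    wt x mu lam * q ^ lam.size = q ^ mu.size * wt (q * x) mu lam := by
  unfold wt
  split_ifs with h
  · rw [← Nat.add_sub_of_le h.size_le, Nat.add_sub_cancel_left]
    ring
  · simp

lemma gsum_wt_mul_wt (x y : ESeries) (mu nu : Ptn) :
    (gsum fun lam => wt x mu lam * wt y nu lam)
      = geom (x * y) * gsum fun kap => wt x kap nu * wt y kap mu := by
  classical
  have h1 : (gsum fun lam => wt x mu lam * wt y nu lam)
      = gsum fun lam : {lam : Ptn // HStrip mu lam ∧ HStrip nu lam} =>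
          x ^ (lam.1.size - mu.size) * y ^ (lam.1.size - nu.size) := by
    rw [← gsum_ite (fun lam => HStrip mu lam ∧ HStrip nu lam) fun lam =>
      x ^ (lam.size - mu.size) * y ^ (lam.size - nu.size)]
    refine congrArg gsum (funext fun lam => ?_)
    by_cases h1 : HStrip mu lam <;> by_cases h2 : HStrip nu lam <;> simp [wt, h1, h2]
  have h2 : (gsum fun kap => wt x kap nu * wt y kap mu)
      = gsum fun kap : {kap : Ptn // HStrip kap mu ∧ HStrip kap nu} =>
          x ^ (nu.size - kap.1.size) * y ^ (mu.size - kap.1.size) := by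
    rw [← gsum_ite (fun kap => HStrip kap mu ∧ HStrip kap nu) fun kap =>
      x ^ (nu.size - kap.size) * y ^ (mu.size - kap.size)]
    refine congrArg gsum (funext fun kap => ?_)
    by_cases h1 : HStrip kap mu <;> by_cases h2 : HStrip kap nu <;> simp [wt, h1, h2]
  rw [h1, h2, ← gsum_equiv (toggle mu nu).symm, gsum_prod, geom, gsum_mul]
  refine congrArg gsum (funext fun a => ?_)
  rw [mul_gsum]
  refine congrArg gsum (funext fun kap => ?_)
  have hs := size_toggle_symm mu nu (a, kap)
  have hk1 := kap.2.1.size_le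
  have hk2 := kap.2.2.size_le
  dsimp only at hs
  rw [show ((toggle mu nu).symm (a, kap)).1.size - mu.size = a + (nu.size - kap.1.size) by omega,
    show ((toggle mu nu).symm (a, kap)).1.size - nu.size = a + (mu.size - kap.1.size) by omega]
  ring

section operators

/-- The linear operator on functions of partitions with a given kernel. -/
noncomputable def kernelOp (k : Ptn → Ptn → ESeries) :
    (Ptn → ESeries) →ₗ[ESeries] (Ptn → ESeries) where
  toFun f mu := gsum fun lam => k mu lam * f lam
  map_add' f g := by
    ext1 mu
    simp only [Pi.add_apply, mul_add, gsum_add]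
  map_smul' c f := by
    ext1 mu
    simp only [Pi.smul_apply, smul_eq_mul, RingHom.id_apply, mul_gsum, mul_left_comm]

/-- Sum over partitions lying above a given one. -/
noncomputable def upOp (x : ESeries) := kernelOp (wt x)

/-- Sum over partitions lying below a given one. -/
noncomputable def downOp (x : ESeries) := kernelOp fun mu nu => wt x nu mu

/-- Multiplication by `q^|μ|`. -/
noncomputable def sizeOp (q : ESeries) : (Ptn → ESeries) →ₗ[ESeries] (Ptn → ESeries) where
  toFun f mu := q ^ mu.size * f mu
  map_add' f g := by
    ext1 mu
    simp only [Pi.add_apply, mul_add]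
  map_smul' c f := by
    ext1 mu
    simp only [Pi.smul_apply, smul_eq_mul, RingHom.id_apply, mul_left_comm]

/-- The bilinear pairing `∑ f(μ) g(μ)`. -/
noncomputable def pairing (f g : Ptn → ESeries) : ESeries := gsum fun mu => f mu * g mu

lemma upOp_apply (x : ESeries) (f : Ptn → ESeries) (mu : Ptn) :
    upOp x f mu = gsum fun lam => wt x mu lam * f lam := rfl

lemma downOp_apply (x : ESeries) (f : Ptn → ESeries) (mu : Ptn) :
    downOp x f mu = gsum fun nu => wt x nu mu * f nu := rfl

lemma sizeOp_apply (q : ESeries) (f : Ptn → ESeries) (mu : Ptn) :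
    sizeOp q f mu = q ^ mu.size * f mu := rfl

lemma upOp_zero (f : Ptn → ESeries) : upOp 0 f = f := by
  classical
  ext1 mu
  simp only [upOp_apply, wt_zero, ite_mul, one_mul, zero_mul]
  exact gsum_single mu f

lemma downOp_zero (f : Ptn → ESeries) : downOp 0 f = f := by
  classical
  ext1 mu
  simp only [downOp_apply, wt_zero, ite_mul, one_mul, zero_mul, eq_comm (b := mu)]
  exact gsum_single mu f

lemma upOp_downOp (x y : ESeries) (f : Ptn → ESeries) :
    upOp x (downOp y f) = geom (x * y) • downOp y (upOp x f) := by
  ext1 mu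
  simp only [Pi.smul_apply, smul_eq_mul, upOp_apply, downOp_apply, mul_gsum]
  rw [gsum_comm]
  have h : ∀ nu, (gsum fun lam => wt x mu lam * (wt y nu lam * f nu))
      = gsum fun kap => geom (x * y) * (wt y kap mu * (wt x kap nu * f nu)) := fun nu => by
    simp only [← mul_assoc, ← gsum_mul]
    rw [gsum_wt_mul_wt, mul_gsum]
    congr 2
    funext kap
    ring
  simp only [h]
  rw [gsum_comm]

lemma wt_mul_wt_one (x : ESeries) (mu lam : Ptn) : wt x mu lam * wt 1 mu lam = wt x mu lam := by
  by_cases h : HStrip mu lam <;> simp [wt, h]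

lemma upOp_one (x : ESeries) : upOp x 1 = geom x • downOp x 1 := by
  ext1 mu
  simpa only [Pi.smul_apply, smul_eq_mul, upOp_apply, downOp_apply, Pi.one_apply, mul_one,
    wt_mul_wt_one] using gsum_wt_mul_wt x 1 mu mu

lemma upOp_sizeOp (q x : ESeries) (f : Ptn → ESeries) :
    upOp x (sizeOp q f) = sizeOp q (upOp (q * x) f) := by
  ext1 mu
  simp only [upOp_apply, sizeOp_apply, mul_gsum, ← mul_assoc, pow_size_mul_wt]

lemma sizeOp_downOp (q x : ESeries) (f : Ptn → ESeries) :
    sizeOp q (downOp x f) = downOp (q * x) (sizeOp q f) := by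
  ext1 mu
  simp only [downOp_apply, sizeOp_apply, mul_gsum, ← mul_assoc, mul_comm (q ^ _) (wt _ _ _),
    pow_size_mul_wt]

lemma sizeOp_sizeOp (p q : ESeries) (f : Ptn → ESeries) :
    sizeOp p (sizeOp q f) = sizeOp (p * q) f := by
  ext1 mu
  simp only [sizeOp_apply, mul_pow, mul_assoc]

lemma pairing_downOp (x : ESeries) (f g : Ptn → ESeries) :
    pairing (downOp x f) g = pairing f (upOp x g) := by
  simp only [pairing, downOp_apply, upOp_apply, gsum_mul, mul_gsum]
  rw [gsum_comm]
  simp only [mul_assoc, mul_left_comm]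

lemma pairing_comm (f g : Ptn → ESeries) : pairing f g = pairing g f := by
  simp only [pairing, mul_comm]

lemma pairing_smul (c : ESeries) (f g : Ptn → ESeries) :
    pairing f (c • g) = c * pairing f g := by
  simp only [pairing, mul_gsum, Pi.smul_apply, smul_eq_mul, mul_left_comm]

lemma pairing_sizeOp (q : ESeries) (f g : Ptn → ESeries) :
    pairing f (sizeOp q g) = pairing (sizeOp q f) g := by
  simp only [pairing, sizeOp_apply, mul_assoc, mul_left_comm]

/-- The composite `Γ₊(x₁) ⋯ Γ₊(xₙ)`. -/
noncomputable def ups (l : List ESeries) (f : Ptn → ESeries) : Ptn → ESeries :=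
  l.foldr (fun x g => upOp x g) f

/-- The composite `Γ₋(x₁) ⋯ Γ₋(xₙ)`. -/
noncomputable def downs (l : List ESeries) (f : Ptn → ESeries) : Ptn → ESeries :=
  l.foldr (fun x g => downOp x g) f

@[simp] lemma ups_nil (f : Ptn → ESeries) : ups [] f = f := rfl

@[simp] lemma ups_cons (x : ESeries) (l : List ESeries) (f : Ptn → ESeries) :
    ups (x :: l) f = upOp x (ups l f) := rfl

lemma ups_append (l l' : List ESeries) (f : Ptn → ESeries) :
    ups (l ++ l') f = ups l (ups l' f) := by
  simp [ups]

@[simp] lemma downs_nil (f : Ptn → ESeries) : downs [] f = f := rfl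

@[simp] lemma downs_cons (x : ESeries) (l : List ESeries) (f : Ptn → ESeries) :
    downs (x :: l) f = downOp x (downs l f) := rfl

lemma downs_append (l l' : List ESeries) (f : Ptn → ESeries) :
    downs (l ++ l') f = downs l (downs l' f) := by
  simp [downs]

lemma downs_smul (l : List ESeries) (c : ESeries) (f : Ptn → ESeries) :
    downs l (c • f) = c • downs l f := by
  induction l with
  | nil => rfl
  | cons x l ih => simp only [downs_cons, ih, map_smul]

lemma upOp_downs (x : ESeries) (l : List ESeries) (f : Ptn → ESeries) :
    upOp x (downs l f) = (l.map fun y => geom (x * y)).prod • downs l (upOp x f) := by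
  induction l with
  | nil => simp
  | cons y l ih =>
    simp only [downs_cons, upOp_downOp, ih, map_smul, smul_smul, List.map_cons, List.prod_cons]

/-- The Littlewood product `∏ᵢ 1/(1-xᵢ) ∏_{i<j} 1/(1-xᵢxⱼ)`. -/
noncomputable def littlewood : List ESeries → ESeries
  | [] => 1
  | x :: l => geom x * (l.map fun y => geom (x * y)).prod * littlewood l

lemma ups_one (l : List ESeries) : ups l 1 = littlewood l • downs l.reverse 1 := by
  induction l with
  | nil => simp [littlewood]
  | cons x l ih =>
    simp only [ups_cons, ih, map_smul, upOp_downs, upOp_one, downs_smul, smul_smul, littlewood,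
      List.reverse_cons, downs_append, downs_cons, downs_nil, List.map_reverse,
      List.prod_reverse]
    congr 1
    ring

lemma ups_sizeOp (q : ESeries) (l : List ESeries) (f : Ptn → ESeries) :
    ups l (sizeOp q f) = sizeOp q (ups (l.map (q * ·)) f) := by
  induction l with
  | nil => rfl
  | cons x l ih => simp only [ups_cons, ih, upOp_sizeOp, List.map_cons]

lemma sizeOp_downs (q : ESeries) (l : List ESeries) (f : Ptn → ESeries) :
    sizeOp q (downs l f) = downs (l.map (q * ·)) (sizeOp q f) := by
  induction l with
  | nil => rfl
  | cons x l ih => simp only [downs_cons, sizeOp_downOp, ih, List.map_cons]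

lemma pairing_downs_reverse (l : List ESeries) (f g : Ptn → ESeries) :
    pairing (downs l.reverse f) g = pairing f (ups l g) := by
  induction l generalizing f with
  | nil => rfl
  | cons x l ih =>
    rw [List.reverse_cons, downs_append, ih, downs_cons, downs_nil, pairing_downOp, ups_cons]

lemma littlewood_perm {l l' : List ESeries} (h : l.Perm l') : littlewood l = littlewood l' := by
  induction h with
  | nil => rfl
  | cons x h ih => simp only [littlewood, ih, (h.map _).prod_eq]
  | swap x y l =>
    simp only [littlewood, List.map_cons, List.prod_cons, mul_comm y x]
    ring
  | trans _ _ ih1 ih2 => exact ih1.trans ih2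

lemma littlewood_append (l l' : List ESeries) :
    littlewood (l ++ l') = littlewood l * littlewood l'
      * (l.map fun x => (l'.map fun y => geom (x * y)).prod).prod := by
  induction l with
  | nil => simp [littlewood]
  | cons x l ih =>
    simp only [List.cons_append, littlewood, ih, List.map_append, List.prod_append,
      List.map_cons, List.prod_cons]
    ring

/-- The generating function of sequences `λ⁰ ≺ ⋯ ≺ λⁿ` weighted by
`q^|λ⁰| ∏ xᵢ^|λⁱ/λⁱ⁻¹|`. -/
noncomputable def reverseGF (q : ESeries) (l : List ESeries) : ESeries :=
  pairing 1 (sizeOp q (ups l 1))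

lemma pairing_ups_one (q : ESeries) (l : List ESeries) (g : Ptn → ESeries) :
    pairing (ups l 1) (sizeOp q g)
      = littlewood l * pairing 1 (sizeOp q (ups (l.map (q * ·)) g)) := by
  rw [ups_one, pairing_comm, pairing_smul, pairing_comm, pairing_downs_reverse, ups_sizeOp]

lemma reverseGF_eq (q : ESeries) (l : List ESeries) :
    reverseGF q l = littlewood l * reverseGF q (l.map (q * ·)) := by
  rw [reverseGF, pairing_sizeOp, pairing_comm, pairing_ups_one, reverseGF]

lemma pairing_normalForm (q : ESeries) (ys xs : List ESeries) :
    pairing 1 (downs ys (sizeOp q (ups xs 1)))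
      = littlewood ys * reverseGF q ((ys.map (q * ·)).reverse ++ xs) := by
  rw [pairing_comm, ← ys.reverse_reverse, pairing_downs_reverse, pairing_comm, pairing_ups_one,
    littlewood_perm ys.reverse_perm, reverseGF, ups_append]
  simp

end operators

section normalForm

open PowerSeries

/-- The relation between consecutive partitions imposed by an entry of the profile. -/
def StepRel (s : ℤ) (mu lam : Ptn) : Prop := if s = 1 then HStrip mu lam else HStrip lam mu

/-- The operator summing over the next partition of a plane partition. -/
noncomputable def stepOp (s : ℤ) : (Ptn → ESeries) →ₗ[ESeries] (Ptn → ESeries) :=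
  if s = 1 then upOp 1 else downOp 1

/-- The generating function of plane partitions with a prescribed initial partition. -/
noncomputable def profileFn : ℕ → (ℕ → ℤ) → Ptn → ESeries
  | 0, _ => sizeOp X 1
  | h + 1, δ => sizeOp X (stepOp (δ 1) (profileFn h fun i => δ (i + 1)))

open Classical in
lemma stepOp_apply (s : ℤ) (f : Ptn → ESeries) (mu : Ptn) :
    stepOp s f mu = gsum fun lam => if StepRel s mu lam then f lam else 0 := by
  unfold stepOp StepRel
  split_ifs with hs
  · simp [upOp_apply, wt]
  · simp [downOp_apply, wt]

lemma isDSPP_succ (h : ℕ) (δ : ℕ → ℤ) (L : Fin (h + 2) → Ptn) :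
    IsDSPP (h + 2) δ L ↔
      StepRel (δ 1) (L 0) (L 1) ∧ IsDSPP (h + 1) (fun i => δ (i + 1)) fun i => L i.succ := by
  constructor
  · exact fun H => ⟨H 0 (by omega), fun i hi => H (i + 1) (by omega)⟩
  · rintro ⟨h0, h1⟩ i hi
    cases i with
    | zero => exact h0
    | succ i => exact h1 i (by omega)

open Classical in
lemma profileFn_eq (h : ℕ) (δ : ℕ → ℤ) (mu : Ptn) :
    profileFn h δ mu = gsum fun L : Fin h → Ptn =>
      if IsDSPP (h + 1) δ (Fin.cons mu L) then
        X ^ (∑ i, Ptn.size ((Fin.cons mu L : Fin (h + 1) → Ptn) i)) else 0 := by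
  induction h generalizing δ mu with
  | zero =>
    have hD : ∀ L, IsDSPP 1 δ L := fun L i hi => by omega
    ext n
    rw [coeff_gsum, tsum_eq_single default fun L hL => (hL (Subsingleton.elim _ _)).elim]
    simp [profileFn, sizeOp_apply, hD]
  | succ h ih =>
    rw [← gsum_equiv (Fin.consEquiv fun _ => Ptn), gsum_prod, profileFn, sizeOp_apply,
      stepOp_apply, mul_gsum]
    refine congrArg gsum (funext fun lam => ?_)
    simp only [isDSPP_succ]
    by_cases hs : StepRel (δ 1) mu lam
    · simp only [hs, if_true, ih, mul_gsum]
      refine congrArg gsum (funext fun L => ?_)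
      simp [Fin.consEquiv, Fin.sum_univ_succ (n := h + 1), hs, pow_add, mul_ite]
    · ext n
      simp [Fin.consEquiv, hs, coeff_gsum]

lemma pairing_profileFn (h : ℕ) (δ : ℕ → ℤ) :
    pairing 1 (profileFn h δ)
      = gsum fun ω : {L : Fin (h + 1) → Ptn // IsDSPP (h + 1) δ L} =>
          X ^ (∑ i, (ω.1 i).size) := by
  classical
  rw [← gsum_ite (IsDSPP (h + 1) δ) fun L => X ^ (∑ i, (L i).size),
    ← gsum_equiv (Fin.consEquiv fun _ => Ptn), gsum_prod]
  simp only [pairing, Pi.one_apply, one_mul, profileFn_eq]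
  rfl

/-- The weights of the descending steps. -/
noncomputable def descents (h : ℕ) (δ : ℕ → ℤ) : List ESeries :=
  (List.range h).map fun i => if δ (i + 1) = -1 then X ^ (i + 1) else 0

/-- The weights of the ascending steps. -/
noncomputable def ascents (h : ℕ) (δ : ℕ → ℤ) : List ESeries :=
  (List.range h).map fun i => if δ (i + 1) = 1 then X ^ (h - i) else 0

/-- The product over inversions of the profile, with all weights scaled by `c`. -/
noncomputable def inversionProd (c : ESeries) (h : ℕ) (δ : ℕ → ℤ) : ESeries :=
  ∏ i ∈ Finset.range h, ∏ j ∈ Finset.range h,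
    if i < j ∧ δ (i + 1) = 1 ∧ δ (j + 1) = -1 then geom (c * X ^ (j - i)) else 1

lemma inversionProd_succ (c : ESeries) (h : ℕ) (δ : ℕ → ℤ) :
    inversionProd c (h + 1) δ
      = (∏ j ∈ Finset.range h,
          if δ 1 = 1 ∧ δ (j + 2) = -1 then geom (c * X ^ (j + 1)) else 1)
        * inversionProd c h fun i => δ (i + 1) := by
  simp [inversionProd, Finset.prod_range_succ', mul_comm]

lemma descents_succ (h : ℕ) (δ : ℕ → ℤ) :
    descents (h + 1) δ = (if δ 1 = -1 then X else 0) ::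
      (descents h fun i => δ (i + 1)).map (X * ·) := by
  simp [descents, List.range_succ_eq_map, pow_succ', mul_ite]

lemma ascents_succ (h : ℕ) (δ : ℕ → ℤ) :
    ascents (h + 1) δ = (if δ 1 = 1 then X ^ (h + 1) else 0) :: ascents h fun i => δ (i + 1) := by
  simp [ascents, List.range_succ_eq_map]

lemma prod_map_range {M : Type*} [CommMonoid M] (f : ℕ → M) (n : ℕ) :
    ((List.range n).map f).prod = ∏ i ∈ Finset.range n, f i := rfl

lemma profileFn_normalForm (h : ℕ) (δ : ℕ → ℤ) (hδ : IsProfile h δ) :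
    profileFn h δ = inversionProd 1 h δ •
      downs (descents h δ) (sizeOp (X ^ (h + 1)) (ups (ascents h δ) 1)) := by
  induction h generalizing δ with
  | zero => simp [profileFn, inversionProd, descents, ascents]
  | succ h ih =>
    rw [profileFn, ih _ fun i h1 h2 => hδ (i + 1) (by omega) (by omega), inversionProd_succ,
      descents_succ, ascents_succ]
    rcases hδ 1 le_rfl (by omega) with h1 | h1
    · simp only [h1, stepOp, if_true, true_and, map_smul, upOp_downs, upOp_sizeOp, sizeOp_downs,
        sizeOp_sizeOp, smul_smul, ← pow_succ', mul_one, downs_cons, ups_cons, one_mul]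
      simp only [show (1 : ℤ) ≠ -1 by decide, if_false, downOp_zero]
      congr 1
      rw [mul_comm]
      congr 1
      rw [descents, List.map_map, prod_map_range]
      refine Finset.prod_congr rfl fun j _ => ?_
      by_cases hj : δ (j + 2) = -1 <;> simp [hj, geom_zero]
    · have hne : (-1 : ℤ) ≠ 1 := by decide
      simp only [h1, stepOp, if_true, hne, if_false, map_smul, sizeOp_downOp, sizeOp_downs,
        sizeOp_sizeOp, ← pow_succ', mul_one, downs_cons, ups_cons, upOp_zero, false_and,
        Finset.prod_const_one, one_mul]

lemma littlewood_range (f : ℕ → ESeries) (h : ℕ) :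
    littlewood ((List.range h).map f) = (∏ i ∈ Finset.range h, geom (f i)) *
      ∏ i ∈ Finset.range h, ∏ j ∈ Finset.range h, if i < j then geom (f i * f j) else 1 := by
  induction h generalizing f with
  | zero => simp [littlewood]
  | succ h ih =>
    have := ih fun i => f (i + 1)
    simp only [List.range_succ_eq_map, List.map_cons, List.map_map, littlewood,
      Finset.prod_range_succ', Function.comp_def, Nat.succ_eq_add_one, this, prod_map_range]
    simp
    ring

end normalForm

section productSide

/-- The `k`-th factor of the infinite product, for a family `g e` standing for `1 / (1 - z^e)`. -/
def wProd {M : Type*} [CommMonoid M] (g : ℕ → M) (m : ℕ) (δ : ℕ → ℤ) (k : ℕ) : M :=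
  ((W1 m δ).map fun t => g (m * k + t)).prod * ((W2 m δ).map fun t => g (2 * m * k + t)).prod

/-- The exponent in `W2` attached to a pair of positions `i < j`, counted from `0`. -/
def pairExponent (h : ℕ) (δ : ℕ → ℤ) (i j : ℕ) : ℕ :=
  if δ (i + 1) = -1 ∧ δ (j + 1) = -1 then i + 1 + (j + 1)
  else if δ (i + 1) = 1 ∧ δ (j + 1) = 1 then 2 * (h + 1) - (i + 1) - (j + 1)
  else if δ (i + 1) < δ (j + 1) then 2 * (h + 1) + (i + 1) - (j + 1)
  else j + 1 - (i + 1)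

/-- The `k`-th factor of the infinite product, without the contribution of `m ∈ W1`. -/
def wRest {M : Type*} [CommMonoid M] (g : ℕ → M) (h : ℕ) (δ : ℕ → ℤ) (k : ℕ) : M :=
  (∏ i ∈ Finset.range h, g ((h + 1) * k + if δ (i + 1) = -1 then i + 1 else h - i)) *
    ∏ i ∈ Finset.range h, ∏ j ∈ Finset.range h,
      if i < j then g (2 * (h + 1) * k + pairExponent h δ i j) else 1

lemma prod_Icc_one {M : Type*} [CommMonoid M] (f : ℕ → M) (h : ℕ) :
    ∏ i ∈ Finset.Icc 1 h, f i = ∏ i ∈ Finset.range h, f (i + 1) := by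
  have : Finset.Icc 1 h = Finset.Ico 1 (h + 1) := by
    ext i
    simp
  rw [this, Finset.prod_Ico_eq_prod_range]
  simp [add_comm]

lemma wProd_eq {M : Type*} [CommMonoid M] (g : ℕ → M) (h : ℕ) (δ : ℕ → ℤ) (k : ℕ) :
    wProd g (h + 1) δ k = wRest g h δ k * g ((h + 1) * (k + 1)) := by
  have h1 : ((W1 (h + 1) δ).map fun t => g ((h + 1) * k + t)).prod
      = g ((h + 1) * (k + 1)) *
        ∏ i ∈ Finset.range h, g ((h + 1) * k + if δ (i + 1) = -1 then i + 1 else h - i) := by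
    rw [W1, Multiset.map_cons, Multiset.prod_cons, Multiset.map_map, mul_add, mul_one,
      ← Finset.prod_eq_multiset_prod, Nat.add_sub_cancel, prod_Icc_one]
    simp
  have h2 : ((W2 (h + 1) δ).map fun t => g (2 * (h + 1) * k + t)).prod
      = ∏ i ∈ Finset.range h, ∏ j ∈ Finset.range h,
          if i < j then g (2 * (h + 1) * k + pairExponent h δ i j) else 1 := by
    rw [W2, Multiset.map_map, ← Finset.prod_eq_multiset_prod, Finset.prod_filter,
      Finset.prod_product, Nat.add_sub_cancel, prod_Icc_one]
    refine Finset.prod_congr rfl fun i _ => ?_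
    rw [prod_Icc_one]
    simp [pairExponent]
  rw [wProd, h1, h2, wRest, mul_assoc, mul_comm]

lemma pairExponent_pos {h i j : ℕ} (δ : ℕ → ℤ) (hij : i < j) (hj : j < h) :
    1 ≤ pairExponent h δ i j := by
  unfold pairExponent
  split_ifs <;> omega

lemma map_wProd {R S : Type*} [CommSemiring R] [CommSemiring S] (φ : R →+* S) {g : ℕ → R}
    {g' : ℕ → S} (hg : ∀ e, 1 ≤ e → φ (g e) = g' e) (h : ℕ) (δ : ℕ → ℤ) (k : ℕ) :
    φ (wProd g (h + 1) δ k) = wProd g' (h + 1) δ k := by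
  rw [wProd_eq, wProd_eq, map_mul, wRest, map_mul, map_prod, map_prod, wRest,
    hg _ (Nat.mul_pos h.succ_pos k.succ_pos)]
  congr 2
  · refine Finset.prod_congr rfl fun i hi => hg _ ?_
    have := Finset.mem_range.mp hi
    split_ifs <;> omega
  · refine Finset.prod_congr rfl fun i hi => ?_
    rw [map_prod]
    refine Finset.prod_congr rfl fun j hj => ?_
    split_ifs with hij
    · have := pairExponent_pos δ hij (Finset.mem_range.mp hj)
      exact hg _ (by omega)
    · exact map_one φ

end productSide

section recursion

open PowerSeries

lemma littlewood_descents (e h : ℕ) (δ : ℕ → ℤ) :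
    littlewood ((descents h δ).map (X ^ e * ·))
      = (∏ i ∈ Finset.range h, if δ (i + 1) = -1 then geom (X ^ (e + (i + 1))) else 1) *
        ∏ i ∈ Finset.range h, ∏ j ∈ Finset.range h,
          if i < j then
            if δ (i + 1) = -1 ∧ δ (j + 1) = -1 then geom (X ^ (2 * e + (i + 1 + (j + 1)))) else 1
          else 1 := by
  rw [descents, List.map_map, littlewood_range]
  congr 1
  · refine Finset.prod_congr rfl fun i _ => ?_
    by_cases hi : δ (i + 1) = -1 <;> simp [hi, geom_zero, pow_add]
  · refine Finset.prod_congr rfl fun i _ => Finset.prod_congr rfl fun j _ => if_congr Iff.rfl ?_ rfl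
    by_cases hi : δ (i + 1) = -1 <;> by_cases hj : δ (j + 1) = -1 <;> simp [hi, hj, geom_zero]
    congr 1
    ring

lemma littlewood_ascents (e h : ℕ) (δ : ℕ → ℤ) :
    littlewood ((ascents h δ).map (X ^ e * ·))
      = (∏ i ∈ Finset.range h, if δ (i + 1) = 1 then geom (X ^ (e + (h - i))) else 1) *
        ∏ i ∈ Finset.range h, ∏ j ∈ Finset.range h,
          if i < j then
            if δ (i + 1) = 1 ∧ δ (j + 1) = 1 then geom (X ^ (2 * e + (h - i + (h - j)))) else 1
          else 1 := by
  rw [ascents, List.map_map, littlewood_range]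
  congr 1
  · refine Finset.prod_congr rfl fun i _ => ?_
    by_cases hi : δ (i + 1) = 1 <;> simp [hi, geom_zero, pow_add]
  · refine Finset.prod_congr rfl fun i _ => Finset.prod_congr rfl fun j _ => if_congr Iff.rfl ?_ rfl
    by_cases hi : δ (i + 1) = 1 <;> by_cases hj : δ (j + 1) = 1 <;> simp [hi, hj, geom_zero]
    congr 1
    ring

lemma cross_prod (a b h : ℕ) (δ : ℕ → ℤ) :
    (((descents h δ).map (X ^ a * ·)).map fun x =>
        (((ascents h δ).map (X ^ b * ·)).map fun y => geom (x * y)).prod).prod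
      = (∏ i ∈ Finset.range h, ∏ j ∈ Finset.range h,
          if i < j then
            if δ (i + 1) = -1 ∧ δ (j + 1) = 1 then geom (X ^ (a + b + (i + 1 + (h - j)))) else 1
          else 1) *
        inversionProd (X ^ (a + b + (h + 1))) h δ := by
  have hswap : inversionProd (X ^ (a + b + (h + 1))) h δ
      = ∏ i ∈ Finset.range h, ∏ j ∈ Finset.range h,
          if j < i ∧ δ (j + 1) = 1 ∧ δ (i + 1) = -1 then
            geom (X ^ (a + b + (h + 1)) * X ^ (i - j)) else 1 := Finset.prod_comm
  rw [hswap, descents, ascents, List.map_map, List.map_map, List.map_map, prod_map_range,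
    ← Finset.prod_mul_distrib]
  refine Finset.prod_congr rfl fun i _ => ?_
  simp only [Function.comp_def, List.map_map, prod_map_range]
  rw [← Finset.prod_mul_distrib]
  refine Finset.prod_congr rfl fun j hj => ?_
  have hj := Finset.mem_range.mp hj
  by_cases h1 : δ (i + 1) = -1 <;> by_cases h2 : δ (j + 1) = 1
  · rcases lt_trichotomy i j with hij | rfl | hij
    · simp only [h1, h2, hij, hij.not_gt, if_true, true_and, false_and, if_false, mul_one]
      congr 1
      ring
    · omega
    · simp only [h1, h2, hij, hij.not_gt, if_true, if_false, one_mul, and_true, ← pow_add]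
      congr 2
      omega
  all_goals simp [h1, h2, geom_zero]

/-- What is left of the generating function after extracting the first `k` factors. -/
noncomputable def remainder (h : ℕ) (δ : ℕ → ℤ) (k : ℕ) : ESeries :=
  inversionProd (X ^ (2 * (h + 1) * k)) h δ *
    littlewood ((descents h δ).map (X ^ ((h + 1) * k) * ·)) *
    reverseGF (X ^ (h + 1))
      (((descents h δ).map (X ^ ((h + 1) * (k + 1)) * ·)).reverse ++
        (ascents h δ).map (X ^ ((h + 1) * k) * ·))

lemma pairing_profileFn_eq_remainder (h : ℕ) (δ : ℕ → ℤ) (hδ : IsProfile h δ) :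
    pairing 1 (profileFn h δ) = remainder h δ 0 := by
  rw [profileFn_normalForm h δ hδ, pairing_smul, pairing_normalForm, remainder]
  simp [mul_assoc]

lemma wRest_geom (h : ℕ) (δ : ℕ → ℤ) (hδ : IsProfile h δ) (k : ℕ) :
    wRest (fun e => geom (X ^ e)) h δ k
      = inversionProd (X ^ (2 * (h + 1) * k)) h δ *
        littlewood ((descents h δ).map (X ^ ((h + 1) * k) * ·)) *
        littlewood ((ascents h δ).map (X ^ ((h + 1) * k) * ·)) *
        ∏ i ∈ Finset.range h, ∏ j ∈ Finset.range h,
          if i < j then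
            if δ (i + 1) = -1 ∧ δ (j + 1) = 1 then
              geom (X ^ ((h + 1) * (k + 1) + (h + 1) * k + (i + 1 + (h - j)))) else 1
          else 1 := by
  rw [littlewood_descents, littlewood_ascents, inversionProd, wRest]
  have hsingle : ∏ i ∈ Finset.range h,
        geom (X ^ ((h + 1) * k + if δ (i + 1) = -1 then i + 1 else h - i))
      = (∏ i ∈ Finset.range h,
          if δ (i + 1) = -1 then geom (X ^ ((h + 1) * k + (i + 1))) else 1) *
        ∏ i ∈ Finset.range h,
          if δ (i + 1) = 1 then geom (X ^ ((h + 1) * k + (h - i))) else 1 := by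
    rw [← Finset.prod_mul_distrib]
    refine Finset.prod_congr rfl fun i hi => ?_
    have hi := Finset.mem_range.mp hi
    rcases hδ (i + 1) (by omega) (by omega) with h1 | h1 <;> simp [h1]
  have hpair : ∀ A B C D E F : ESeries, E = A * C * D * F →
      ∀ P Q : ESeries, P * Q * E = A * (P * C) * (Q * D) * F := by
    rintro A B C D E F rfl P Q
    ring
  rw [hsingle]
  refine hpair _ 1 _ _ _ _ ?_ _ _
  simp only [← Finset.prod_mul_distrib]
  refine Finset.prod_congr rfl fun i hi => Finset.prod_congr rfl fun j hj => ?_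
  have hi := Finset.mem_range.mp hi
  have hj := Finset.mem_range.mp hj
  by_cases hij : i < j
  · rcases hδ (i + 1) (by omega) (by omega) with h1 | h1 <;>
      rcases hδ (j + 1) (by omega) (by omega) with h2 | h2 <;>
      simp [hij, h1, h2, pairExponent, ← pow_add] <;> congr 2
    · have : 2 * ((h + 1) * k) = 2 * (h + 1) * k := by ring
      omega
    · have : (h + 1) * (k + 1) + (h + 1) * k = 2 * (h + 1) * k + (h + 1) := by ring
      omega
    · ring
  · simp [hij]

lemma remainder_eq (h : ℕ) (δ : ℕ → ℤ) (hδ : IsProfile h δ) (k : ℕ) :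
    remainder h δ k = wRest (fun e => geom (X ^ e)) h δ k * remainder h δ (k + 1) := by
  have hmap : ∀ (l : List ESeries) (a : ℕ), (l.map (X ^ ((h + 1) * a) * ·)).map (X ^ (h + 1) * ·)
      = l.map (X ^ ((h + 1) * (a + 1)) * ·) := fun l a => by
    rw [List.map_map]
    refine List.map_congr_left fun x _ => ?_
    simp only [Function.comp_def]
    ring
  have hexp : (h + 1) * (k + 1) + (h + 1) * k + (h + 1) = 2 * (h + 1) * (k + 1) := by ring
  rw [wRest_geom h δ hδ, remainder, reverseGF_eq, littlewood_append,
    littlewood_perm (List.reverse_perm _), List.map_reverse, List.prod_reverse, cross_prod, hexp,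
    List.map_append, List.map_reverse, hmap, hmap, remainder]
  ring

lemma remainder_zero_eq (h : ℕ) (δ : ℕ → ℤ) (hδ : IsProfile h δ) (K : ℕ) :
    remainder h δ 0
      = (∏ k ∈ Finset.range K, wRest (fun e => geom (X ^ e)) h δ k) * remainder h δ K := by
  induction K with
  | zero => simp
  | succ K ih => rw [ih, remainder_eq h δ hδ, Finset.prod_range_succ, mul_assoc]

end recursion

section congruence

open PowerSeries

/-- Two power series agree modulo `X^K`. -/
def CongMod {R : Type*} [CommSemiring R] (K : ℕ) (a b : PowerSeries R) : Prop :=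
  ∀ n < K, coeff n a = coeff n b

namespace CongMod

variable {R : Type*} [CommSemiring R] {K : ℕ} {a b c d : PowerSeries R}

lemma refl (K : ℕ) (a : PowerSeries R) : CongMod K a a := fun _ _ => rfl

lemma trans (h : CongMod K a b) (h' : CongMod K b c) : CongMod K a c :=
  fun n hn => (h n hn).trans (h' n hn)

lemma mul (h : CongMod K a b) (h' : CongMod K c d) : CongMod K (a * c) (b * d) := fun n hn => by
  rw [coeff_mul, coeff_mul]
  refine Finset.sum_congr rfl fun p hp => ?_
  have := Finset.HasAntidiagonal.mem_antidiagonal.mp hp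
  rw [h _ (by omega), h' _ (by omega)]

lemma pow (h : CongMod K a b) (n : ℕ) : CongMod K (a ^ n) (b ^ n) := by
  induction n with
  | zero => simpa using refl K 1
  | succ n ih => simpa only [pow_succ] using ih.mul h

lemma prod {ι : Type*} {s : Finset ι} {f g : ι → PowerSeries R}
    (h : ∀ i ∈ s, CongMod K (f i) (g i)) : CongMod K (∏ i ∈ s, f i) (∏ i ∈ s, g i) := by
  classical
  induction s using Finset.induction_on with
  | empty => exact refl K 1
  | insert i s hi ih =>
    rw [Finset.prod_insert hi, Finset.prod_insert hi]
    exact (h i (by simp)).mul (ih fun j hj => h j (by simp [hj]))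

lemma mul_eq_one (h : CongMod K a 1) (h' : CongMod K b 1) : CongMod K (a * b) 1 := by
  simpa using h.mul h'

lemma prod_eq_one {ι : Type*} {s : Finset ι} {f : ι → PowerSeries R}
    (h : ∀ i ∈ s, CongMod K (f i) 1) : CongMod K (∏ i ∈ s, f i) 1 := by
  simpa using prod h

lemma list_prod_eq_one {l : List (PowerSeries R)} (h : ∀ x ∈ l, CongMod K x 1) :
    CongMod K l.prod 1 := by
  induction l with
  | nil => exact refl K 1
  | cons x l ih =>
    simpa using (h x (by simp)).mul (ih fun y hy => h y (by simp [hy]))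

lemma mul_left_zero (h : CongMod K a 0) (b : PowerSeries R) : CongMod K (a * b) 0 := by
  simpa using h.mul (refl K b)

lemma X_pow {e : ℕ} (h : K ≤ e) : CongMod K (X ^ e : PowerSeries R) 0 := fun n hn => by
  rw [coeff_X_pow, if_neg (by omega), map_zero]

lemma gsum {ι : Type*} {f g : ι → ESeries} (h : ∀ i, CongMod K (f i) (g i)) :
    CongMod K (gsum f) (gsum g) := fun n hn => by
  simp only [coeff_gsum]
  exact tsum_congr fun i => h i n hn

lemma geom {x : ESeries} (h : CongMod K x 0) : CongMod K (geom x) 1 := by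
  rw [← geom_zero]
  exact gsum fun n => h.pow n

lemma pairing {f f' g g' : Ptn → ESeries} (hf : ∀ mu, CongMod K (f mu) (f' mu))
    (hg : ∀ mu, CongMod K (g mu) (g' mu)) : CongMod K (pairing f g) (pairing f' g') :=
  gsum fun mu => (hf mu).mul (hg mu)

lemma wt {x : ESeries} (h : CongMod K x 0) (mu lam : Ptn) :
    CongMod K (wt x mu lam) (wt 0 mu lam) := by
  unfold _root_.wt
  split_ifs
  · exact h.pow _
  · exact refl K 0

lemma upOp {x : ESeries} (h : CongMod K x 0) (f : Ptn → ESeries) (mu : Ptn) :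
    CongMod K (upOp x f mu) (f mu) := by
  conv => arg 3; rw [← upOp_zero f]
  exact gsum fun lam => (h.wt mu lam).mul (refl K _)

lemma ups {l : List ESeries} (h : ∀ x ∈ l, CongMod K x 0) (f : Ptn → ESeries) (mu : Ptn) :
    CongMod K (ups l f mu) (f mu) := by
  induction l with
  | nil => exact refl K _
  | cons x l ih =>
    exact ((h x (by simp)).upOp _ mu).trans (ih fun y hy => h y (by simp [hy]))

lemma littlewood {l : List ESeries} (h : ∀ x ∈ l, CongMod K x 0) :
    CongMod K (littlewood l) 1 := by
  induction l with
  | nil => exact refl K 1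
  | cons x l ih =>
    have hx := h x (by simp)
    have h1 : CongMod K (l.map fun y => _root_.geom (x * y)).prod 1 := by
      refine list_prod_eq_one fun y hy => ?_
      obtain ⟨y, _, rfl⟩ := List.mem_map.mp hy
      exact (hx.mul_left_zero y).geom
    simpa [_root_.littlewood] using (hx.geom.mul h1).mul (ih fun y hy => h y (by simp [hy]))

lemma inversionProd {c : ESeries} (hc : CongMod K c 0) (h : ℕ) (δ : ℕ → ℤ) :
    CongMod K (inversionProd c h δ) 1 := by
  refine prod_eq_one fun i _ => prod_eq_one fun j _ => ?_
  split_ifs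
  · exact (hc.mul_left_zero _).geom
  · exact refl K 1

lemma reverseGF (q : ESeries) {l : List ESeries} (h : ∀ x ∈ l, CongMod K x 0) :
    CongMod K (reverseGF q l) (_root_.pairing 1 (sizeOp q 1)) :=
  pairing (fun _ => refl K _) fun mu => (refl K (q ^ mu.size)).mul (ups h 1 mu)

lemma remainder (h : ℕ) (δ : ℕ → ℤ) (K : ℕ) :
    CongMod K (remainder h δ K) (_root_.pairing 1 (sizeOp (X ^ (h + 1)) 1)) := by
  have hmap : ∀ (e : ℕ) (l : List ESeries), K ≤ e → ∀ x ∈ l.map ((X : ESeries) ^ e * ·), CongMod K x 0 := by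
    intro e l he x hx
    obtain ⟨y, _, rfl⟩ := List.mem_map.mp hx
    exact (X_pow he).mul_left_zero y
  have hK : K ≤ (h + 1) * K := Nat.le_mul_of_pos_left K h.succ_pos
  have hK' : K ≤ (h + 1) * (K + 1) := hK.trans (Nat.mul_le_mul_left _ K.le_succ)
  have hK2 : K ≤ 2 * (h + 1) * K := Nat.le_mul_of_pos_left K (by omega)
  have := ((inversionProd (X_pow (R := ENNReal) hK2) h δ).mul (littlewood (hmap _ (descents h δ) hK))).mul
    (reverseGF (X ^ (h + 1)) (l := ((descents h δ).map (X ^ ((h + 1) * (K + 1)) * ·)).reverse ++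
        (ascents h δ).map (X ^ ((h + 1) * K) * ·)) fun x hx => by
      rcases List.mem_append.mp hx with hx | hx
      · exact hmap _ _ hK' x (List.mem_reverse.mp hx)
      · exact hmap _ _ hK x hx)
  simpa [_root_.remainder] using this

end CongMod

end congruence

section partitions

open PowerSeries

/-- The generating function of partitions with at most `N` parts. -/
noncomputable def boundedGF (q : ESeries) (N : ℕ) : ESeries :=
  gsum fun mu : {mu : Ptn // mu.part N = 0} => q ^ mu.1.size

/-- Removing all columns of length `N + 1` from a partition with at most `N + 1` parts. -/
noncomputable def columnEquiv (N : ℕ) :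
    {mu : Ptn // mu.part (N + 1) = 0} ≃ ℕ × {mu : Ptn // mu.part N = 0} where
  toFun mu :=
    ⟨mu.1.part N,
      Ptn.ofFun (fun i => mu.1.part i - mu.1.part N)
        (fun i => by
          have := mu.1.part_anti (Nat.le_succ i)
          simp only [Nat.succ_eq_add_one] at this
          omega)
        ⟨N, fun i hi => Nat.sub_eq_zero_of_le (mu.1.part_anti hi)⟩,
      by simp⟩
  invFun p :=
    ⟨Ptn.ofFun (fun i => if i ≤ N then p.2.1.part i + p.1 else 0)
        (fun i => by
          have := p.2.1.part_anti (Nat.le_succ i)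
          simp only [Nat.succ_eq_add_one] at this
          split_ifs <;> omega)
        ⟨N + 1, fun i hi => if_neg (by omega)⟩,
      by simp⟩
  left_inv mu := by
    ext i
    simp only [Ptn.part_ofFun]
    split_ifs with hi
    · exact Nat.sub_add_cancel (mu.1.part_anti hi)
    · have := mu.1.part_anti (show N + 1 ≤ i by omega)
      have := mu.2
      omega
  right_inv p := by
    have hp := p.2.2
    refine Prod.ext (by simp [hp]) (Subtype.ext (Ptn.ext_part fun i => ?_))
    simp only [Ptn.part_ofFun, hp, le_refl, if_true]
    split_ifs with hi
    · omega
    · have := p.2.1.part_anti (show N ≤ i by omega)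
      omega

lemma size_columnEquiv_symm (N : ℕ) (p : ℕ × {mu : Ptn // mu.part N = 0}) :
    ((columnEquiv N).symm p).1.size = (N + 1) * p.1 + p.2.1.size := by
  have hp : ∀ i, N + 1 ≤ i → p.2.1.part i = 0 := fun i hi => by
    have := p.2.1.part_anti (show N ≤ i by omega)
    have := p.2.2
    omega
  have hs : ∀ i, N + 1 ≤ i → ((columnEquiv N).symm p).1.part i = 0 := fun i hi => by
    simp only [columnEquiv, Equiv.coe_fn_symm_mk, Ptn.part_ofFun]
    exact if_neg (by omega)
  rw [Ptn.size_eq_sum _ hs, Ptn.size_eq_sum _ hp]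
  have : ∀ i ∈ Finset.range (N + 1),
      ((columnEquiv N).symm p).1.part i = p.2.1.part i + p.1 := fun i hi => by
    simp only [columnEquiv, Equiv.coe_fn_symm_mk, Ptn.part_ofFun]
    exact if_pos (by have := Finset.mem_range.mp hi; omega)
  rw [Finset.sum_congr rfl this, Finset.sum_add_distrib]
  simp [add_comm]

lemma boundedGF_zero (q : ESeries) : boundedGF q 0 = 1 := by
  have hz : ∀ mu : Ptn, mu.part 0 = 0 → ∀ i, mu.part i = 0 := fun mu h i => by
    have := mu.part_anti (Nat.zero_le i)
    omega
  let e : {mu : Ptn // mu.part 0 = 0} ≃ Unit :=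
    { toFun := fun _ => ()
      invFun := fun _ => ⟨Ptn.ofFun (fun _ => 0) (fun _ => le_rfl) ⟨0, fun _ _ => rfl⟩, rfl⟩
      left_inv := fun mu => Subtype.ext (Ptn.ext_part fun i => (hz mu.1 mu.2 i).symm)
      right_inv := fun _ => rfl }
  have h1 : boundedGF q 0 = gsum fun mu : {mu : Ptn // mu.part 0 = 0} => (fun _ => 1) (e mu) := by
    refine congrArg gsum (funext fun mu => ?_)
    rw [mu.1.size_eq_sum (N := 0) fun i _ => hz mu.1 mu.2 i]
    simp
  rw [h1, gsum_equiv e fun _ => 1]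
  ext n
  simp [coeff_gsum]

lemma boundedGF_succ (q : ESeries) (N : ℕ) :
    boundedGF q (N + 1) = geom (q ^ (N + 1)) * boundedGF q N := by
  rw [boundedGF, ← gsum_equiv (columnEquiv N).symm, gsum_prod, geom, gsum_mul]
  refine congrArg gsum (funext fun a => ?_)
  rw [boundedGF, mul_gsum]
  refine congrArg gsum (funext fun mu => ?_)
  rw [size_columnEquiv_symm, pow_add, pow_mul]

lemma boundedGF_eq (q : ESeries) (N : ℕ) :
    boundedGF q N = ∏ k ∈ Finset.range N, geom (q ^ (k + 1)) := by
  induction N with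
  | zero => exact boundedGF_zero q
  | succ N ih => rw [boundedGF_succ, ih, Finset.prod_range_succ, mul_comm]

lemma Ptn.le_size_of_part_ne_zero {mu : Ptn} {N : ℕ} (h : mu.part N ≠ 0) : N ≤ mu.size := by
  obtain ⟨M, hM⟩ := mu.exists_bound
  have hNM : N ≤ M := by
    by_contra hc
    exact h (hM N (by omega))
  rw [mu.size_eq_sum hM]
  calc N = ∑ i ∈ Finset.range N, 1 := by simp
    _ ≤ ∑ i ∈ Finset.range N, mu.part i := Finset.sum_le_sum fun i hi => by
        have := mu.part_anti (Finset.mem_range.mp hi).le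
        omega
    _ ≤ _ := Finset.sum_le_sum_of_subset (Finset.range_mono hNM)

lemma congMod_boundedGF (h K : ℕ) :
    CongMod K (pairing 1 (sizeOp (X ^ (h + 1)) 1)) (boundedGF (X ^ (h + 1)) K) := by
  classical
  rw [boundedGF, ← gsum_ite (fun mu : Ptn => mu.part K = 0) fun mu => (X ^ (h + 1)) ^ mu.size]
  refine CongMod.gsum fun mu => ?_
  simp only [sizeOp_apply, Pi.one_apply, one_mul, mul_one]
  split_ifs with hmu
  · exact CongMod.refl K _
  · rw [← pow_mul]
    exact CongMod.X_pow ((Ptn.le_size_of_part_ne_zero hmu).trans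
      (Nat.le_mul_of_pos_left _ h.succ_pos))

lemma congMod_pairing_profileFn (h : ℕ) (δ : ℕ → ℤ) (hδ : IsProfile h δ) (K : ℕ) :
    CongMod K (pairing 1 (profileFn h δ))
      (∏ k ∈ Finset.range K, wProd (fun e => geom (X ^ e)) (h + 1) δ k) := by
  rw [pairing_profileFn_eq_remainder h δ hδ, remainder_zero_eq h δ hδ K]
  simp only [wProd_eq, Finset.prod_mul_distrib, pow_mul]
  rw [← boundedGF_eq]
  exact (CongMod.refl K _).mul ((CongMod.remainder h δ K).trans (congMod_boundedGF h K))

end partitions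

section transfer

open PowerSeries

/-- The series `1 / (1 - X^e)` for `e ≥ 1`, with natural number coefficients. -/
noncomputable def natGeom (e : ℕ) : PowerSeries ℕ := mk fun n => if e ∣ n then 1 else 0

lemma map_natGeom_ennreal {e : ℕ} (he : 1 ≤ e) :
    PowerSeries.map (Nat.castRingHom ENNReal) (natGeom e) = geom (X ^ e) := by
  ext n
  simp only [coeff_map, natGeom, coeff_mk, geom, coeff_gsum, ← pow_mul, coeff_X_pow]
  by_cases h : e ∣ n
  · obtain ⟨a, rfl⟩ := h
    rw [tsum_eq_single a]
    · simp
    · intro b hb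
      rw [if_neg]
      exact fun hab => hb (Nat.eq_of_mul_eq_mul_left he hab.symm)
  · rw [if_neg h]
    have : ∀ b, n ≠ e * b := fun b hb => h ⟨b, hb⟩
    simp [this]

lemma map_natGeom_rat {e : ℕ} (he : 1 ≤ e) :
    PowerSeries.map (Nat.castRingHom ℚ) (natGeom e) = (1 - X ^ e)⁻¹ := by
  have hc : constantCoeff (1 - X ^ e : PowerSeries ℚ) ≠ 0 := by
    simp [show e ≠ 0 by omega]
  rw [PowerSeries.eq_inv_iff_mul_eq_one hc]
  ext n
  rw [mul_sub, mul_one, map_sub, coeff_mul_X_pow', coeff_one]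
  simp only [coeff_map, natGeom, coeff_mk]
  by_cases hn : e ≤ n
  · have h0 : n ≠ 0 := by omega
    simp [hn, h0, Nat.dvd_sub_iff_left hn dvd_rfl]
  · by_cases h0 : n = 0
    · simp [h0, show e ≠ 0 by omega]
    · have : ¬ e ∣ n := fun hd => hn (Nat.le_of_dvd (by omega) hd)
      simp [hn, h0, this]

lemma congMod_natGeom {K e : ℕ} (h : K ≤ e) : CongMod K (natGeom e) 1 := fun n hn => by
  rw [natGeom, coeff_mk, coeff_one]
  by_cases h0 : n = 0
  · simp [h0]
  · have : ¬ e ∣ n := fun hd => by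
      have := Nat.le_of_dvd (by omega) hd
      omega
    simp [h0, this]

lemma congMod_wProd (h : ℕ) (δ : ℕ → ℤ) (k : ℕ) :
    CongMod (k + 1) (wProd natGeom (h + 1) δ k) 1 := by
  have hk : k ≤ (h + 1) * k := Nat.le_mul_of_pos_left k h.succ_pos
  have hk2 : k ≤ 2 * (h + 1) * k := Nat.le_mul_of_pos_left k (by omega)
  rw [wProd_eq, wRest]
  refine ((CongMod.prod_eq_one fun i hi => congMod_natGeom ?_).mul_eq_one
    (CongMod.prod_eq_one fun i hi => CongMod.prod_eq_one fun j hj => ?_)).mul_eq_one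
    (congMod_natGeom (Nat.le_mul_of_pos_left _ h.succ_pos))
  · have := Finset.mem_range.mp hi
    split_ifs <;> omega
  · split_ifs with hij
    · have := pairExponent_pos δ hij (Finset.mem_range.mp hj)
      exact congMod_natGeom (by omega)
    · exact CongMod.refl _ 1

/-- The coefficient of `X^n` in the product side. -/
noncomputable def prodCoeff (h : ℕ) (δ : ℕ → ℤ) (n : ℕ) : ℕ :=
  coeff n (∏ k ∈ Finset.range (n + 1), wProd natGeom (h + 1) δ k)

lemma coeff_prod_wProd (h : ℕ) (δ : ℕ → ℤ) (n : ℕ) {s : Finset ℕ}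
    (hs : Finset.range (n + 1) ⊆ s) :
    coeff n (∏ k ∈ s, wProd natGeom (h + 1) δ k) = prodCoeff h δ n := by
  rw [prodCoeff, ← Finset.prod_sdiff hs]
  have h1 : CongMod (n + 1) (∏ k ∈ s \ Finset.range (n + 1), wProd natGeom (h + 1) δ k) 1 := by
    refine CongMod.prod_eq_one fun k hk m hm => congMod_wProd h δ k m ?_
    have : ¬ k < n + 1 := fun hc => (Finset.mem_sdiff.mp hk).2 (Finset.mem_range.mpr hc)
    omega
  have h2 := h1.mul (CongMod.refl (n + 1) (∏ k ∈ Finset.range (n + 1), wProd natGeom (h + 1) δ k))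
  rw [one_mul] at h2
  exact h2 n n.lt_succ_self

lemma hasSum_of_tsum_natCast {ι : Type*} {f : ι → ℕ} {c : ℕ}
    (h : ∑' i, (f i : ENNReal) = c) : HasSum (fun i => (f i : ℚ)) c := by
  have hfin : {i | 1 ≤ (f i : ENNReal)}.Finite :=
    ENNReal.finite_const_le_of_tsum_ne_top (h ▸ ENNReal.natCast_ne_top c) one_ne_zero
  have hz : ∀ i ∉ hfin.toFinset, f i = 0 := fun i hi => by
    by_contra hne
    refine hi (hfin.mem_toFinset.mpr ?_)
    exact_mod_cast Nat.one_le_iff_ne_zero.mpr hne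
  rw [tsum_eq_sum fun i hi => by rw [hz i hi, Nat.cast_zero], ← Nat.cast_sum,
    Nat.cast_inj (R := ENNReal)] at h
  rw [← h, Nat.cast_sum]
  exact hasSum_sum_of_ne_finset_zero fun i hi => by rw [hz i hi, Nat.cast_zero]

lemma hasSum_coeff (h : ℕ) (δ : ℕ → ℤ) (hδ : IsProfile h δ) (n : ℕ) :
    HasSum (fun ω : {L : Fin (h + 1) → Ptn // IsDSPP (h + 1) δ L} =>
      coeff n (X ^ (∑ i, (ω.1 i).size) : PowerSeries ℚ)) (prodCoeff h δ n) := by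
  have key := congMod_pairing_profileFn h δ hδ (n + 1) n n.lt_succ_self
  have hmap : (∏ k ∈ Finset.range (n + 1), wProd (fun e => geom (X ^ e)) (h + 1) δ k)
      = PowerSeries.map (Nat.castRingHom ENNReal)
          (∏ k ∈ Finset.range (n + 1), wProd natGeom (h + 1) δ k) := by
    rw [map_prod]
    exact Finset.prod_congr rfl fun k _ =>
      (map_wProd _ (fun e he => map_natGeom_ennreal he) h δ k).symm
  rw [pairing_profileFn, coeff_gsum, hmap, coeff_map, eq_natCast,
    ← prodCoeff] at key
  have := hasSum_of_tsum_natCast (c := prodCoeff h δ n)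
    (f := fun ω : {L : Fin (h + 1) → Ptn // IsDSPP (h + 1) δ L} =>
      if n = ∑ i, (ω.1 i).size then 1 else 0) (by
        simpa only [coeff_X_pow, Nat.cast_ite, Nat.cast_one, Nat.cast_zero] using key)
  simpa only [coeff_X_pow, Nat.cast_ite, Nat.cast_one, Nat.cast_zero] using this

end transfer

/-- **Theorem 5.1**: the generating function for skew doubled shifted plane
partitions with profile `δ = (δ_1, …, δ_{m-1})` is
`Σ_{ω ∈ DSPP_δ} z^{|ω|}
  = ∏_{k≥0} (∏_{t ∈ W_1(δ)} (1 - z^{mk+t})⁻¹) (∏_{t ∈ W_2(δ)} (1 - z^{2mk+t})⁻¹)`. -/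
theorem gf_skew_doubled_shifted_plane_partitions (m : ℕ) (hm : 2 ≤ m) (δ : ℕ → ℤ)
    (hδ : IsProfile (m - 1) δ) :
    ∑' ω : {L : Fin m → Ptn // IsDSPP m δ L}, z ^ (∑ i, (ω.1 i).size)
    = ∏' k : ℕ,
        ((W1 m δ).map (fun t => (1 - z ^ (m * k + t))⁻¹)).prod *
          ((W2 m δ).map (fun t => (1 - z ^ (2 * m * k + t))⁻¹)).prod := by
  obtain ⟨h, rfl⟩ : ∃ h, m = h + 1 := ⟨m - 1, by omega⟩
  have hsum : HasSum (fun ω : {L : Fin (h + 1) → Ptn // IsDSPP (h + 1) δ L} =>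
      z ^ (∑ i, (ω.1 i).size)) (PowerSeries.mk fun n => (prodCoeff h δ n : ℚ)) := by
    refine (PowerSeries.WithPiTopology.hasSum_iff_hasSum_coeff (R := ℚ)).mpr fun n => ?_
    rw [PowerSeries.coeff_mk]
    exact hasSum_coeff h δ hδ n
  have hprod : HasProd (fun k => wProd (fun e => (1 - z ^ e)⁻¹) (h + 1) δ k)
      (PowerSeries.mk fun n => (prodCoeff h δ n : ℚ)) := by
    refine (PowerSeries.WithPiTopology.tendsto_iff_coeff_tendsto (R := ℚ) _ _ _).mpr fun n => ?_
    refine tendsto_const_nhds.congr' ?_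
    filter_upwards [Filter.eventually_ge_atTop (Finset.range (n + 1))] with s hs
    have hmap : ∏ k ∈ s, wProd (fun e => (1 - z ^ e)⁻¹) (h + 1) δ k
        = PowerSeries.map (Nat.castRingHom ℚ) (∏ k ∈ s, wProd natGeom (h + 1) δ k) := by
      rw [map_prod]
      exact Finset.prod_congr rfl fun k _ =>
        (map_wProd _ (fun e he => map_natGeom_rat he) h δ k).symm
    rw [hmap, PowerSeries.coeff_map, coeff_prod_wProd h δ n hs, PowerSeries.coeff_mk]
    rfl
  have : T2Space (PowerSeries ℚ) := PowerSeries.WithPiTopology.instT2Space ℚ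
  exact hsum.tsum_eq.trans hprod.tprod_eq.symm
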